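/- For every complex ζ and every τ in the complex upper half-plane, θ[1,3/5](τ)²·θ[1/5,1/5](ζ,τ)·θ[1/5,3/5](ζ,τ) + ζ₅²·θ[1,1/5](τ)²·θ[1/5,1](ζ,τ)·θ[1/5,9/5](ζ,τ) − ζ₅²·θ[1,1/5](τ)·θ[1,3/5](τ)·θ[1/5,7/5](ζ,τ)² = 0. -/

import Mathlib

open Complex

/-- The theta function with characteristic `[ε; ε']`:
`θ[ε,ε'](ζ,τ) = ∑_{n ∈ ℤ} exp(2πi((1/2)(n+ε/2)²τ + (n+ε/2)(ζ+ε'/2)))`. -/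
noncomputable def θf (ε ε' : ℝ) (ζ τ : ℂ) : ℂ :=
  ∑' n : ℤ, Complex.exp (2 * Real.pi * Complex.I *
    ((1 / 2) * ((n : ℂ) + (ε : ℂ) / 2) ^ 2 * τ + ((n : ℂ) + (ε : ℂ) / 2) * (ζ + (ε' : ℂ) / 2)))

/-- The theta constant: the value of the theta function at `ζ = 0`. -/
noncomputable def θ (ε ε' : ℝ) (τ : ℂ) : ℂ := θf ε ε' 0 τ

/-- `ζ₅ = exp(2πi/5)`. -/
noncomputable def ζ₅ : ℂ := Complex.exp (2 * Real.pi * Complex.I / 5)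

/-- The summand of the series defining `θf`. -/
noncomputable def θfTerm (ε ε' : ℝ) (ζ τ : ℂ) (n : ℤ) : ℂ :=
  Complex.exp (2 * Real.pi * Complex.I *
    ((1 / 2) * ((n : ℂ) + (ε : ℂ) / 2) ^ 2 * τ + ((n : ℂ) + (ε : ℂ) / 2) * (ζ + (ε' : ℂ) / 2)))

theorem summable_θfTerm (ε ε' : ℝ) (ζ : ℂ) {τ : ℂ} (hτ : 0 < τ.im) :
    Summable (θfTerm ε ε' ζ τ) := by
  have h := ((summable_jacobiTheta₂_term_iff (ζ + ε' / 2 + ε / 2 * τ) τ).2 hτ).mul_left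
    (Complex.exp (2 * Real.pi * Complex.I *
      ((1 / 2) * ((ε : ℂ) / 2) ^ 2 * τ + (ε : ℂ) / 2 * (ζ + (ε' : ℂ) / 2))))
  refine h.congr fun n => ?_
  rw [θfTerm, jacobiTheta₂_term, ← Complex.exp_add]
  congr 1
  ring

theorem hasSum_θfTerm_mul_θfTerm (a a' b b' : ℝ) (u v : ℂ) {τ : ℂ} (hτ : 0 < τ.im) :
    HasSum (fun p : ℤ × ℤ => θfTerm a a' u τ p.1 * θfTerm b b' v τ p.2)
      (θf a a' u τ * θf b b' v τ) :=
  (summable_θfTerm a a' u hτ).hasSum.mul (summable_θfTerm b b' v hτ).hasSum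
    (summable_mul_of_summable_norm (summable_θfTerm a a' u hτ).norm
      (summable_θfTerm b b' v hτ).norm)

theorem exp_add_intCast_mul_two_pi_mul_I (z : ℂ) (n : ℤ) :
    Complex.exp (z + n * (2 * Real.pi * Complex.I)) = Complex.exp z := by
  rw [Complex.exp_add, Complex.exp_int_mul_two_pi_mul_I, mul_one]

/-- Up to an exponential factor, every theta function is a translate of the odd one `θ[1,1]`. -/
theorem θf_eq_exp_mul_θf_one_one (ε ε' : ℝ) (ζ τ : ℂ) :
    θf ε ε' ζ τ = Complex.exp (2 * Real.pi * Complex.I *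
      ((1 / 2) * (((ε : ℂ) - 1) / 2) ^ 2 * τ + ((ε : ℂ) - 1) / 2 * (ζ + (ε' : ℂ) / 2))) *
        θf 1 1 (ζ + ((ε : ℂ) - 1) / 2 * τ + ((ε' : ℂ) - 1) / 2) τ := by
  rw [θf, θf, ← tsum_mul_left]
  refine tsum_congr fun n => ?_
  rw [← Complex.exp_add]
  congr 1
  push_cast
  ring

theorem θf_one_one_add_one (ζ τ : ℂ) : θf 1 1 (ζ + 1) τ = -θf 1 1 ζ τ := by
  rw [θf, θf, ← tsum_neg]
  refine tsum_congr fun n => ?_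
  rw [← mul_neg_one, ← Complex.exp_pi_mul_I, ← Complex.exp_add,
    ← exp_add_intCast_mul_two_pi_mul_I (_ + Real.pi * Complex.I) n]
  congr 1
  push_cast
  ring

theorem θf_one_one_neg (ζ τ : ℂ) : θf 1 1 (-ζ) τ = -θf 1 1 ζ τ := by
  rw [θf, θf, ← tsum_neg, ← (Equiv.subLeft (-1 : ℤ)).tsum_eq]
  refine tsum_congr fun n => ?_
  rw [neg_eq_neg_one_mul (Complex.exp _), ← Complex.exp_pi_mul_I, ← Complex.exp_add,
    ← exp_add_intCast_mul_two_pi_mul_I _ (n + 1)]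
  congr 1
  simp only [Equiv.subLeft_apply]
  push_cast
  ring

theorem injective_add_sub_sub (c : ℤ) :
    Function.Injective fun p : ℤ × ℤ => (p.1 + p.2, p.1 - p.2 - c) := by
  rintro ⟨k, l⟩ ⟨m, n⟩ h
  simp only [Prod.mk.injEq] at h ⊢
  lia

theorem isCompl_range_add_sub :
    IsCompl (Set.range fun p : ℤ × ℤ => (p.1 + p.2, p.1 - p.2 - 1))
      (Set.range fun p : ℤ × ℤ => (p.1 + p.2, p.1 - p.2)) := by
  rw [isCompl_iff, Set.disjoint_left, codisjoint_iff, Set.top_eq_univ, Set.eq_univ_iff_forall]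
  constructor
  · rintro _ ⟨⟨a, b⟩, rfl⟩ ⟨⟨c, d⟩, h⟩
    simp only [Prod.mk.injEq] at h
    lia
  · rintro ⟨m, n⟩
    rcases Int.even_or_odd' (m - n) with ⟨l, hl | hl⟩
    · exact Or.inr ⟨(n + l, l), by simp only [Prod.mk.injEq]; lia⟩
    · exact Or.inl ⟨(n + l + 1, l), by simp only [Prod.mk.injEq]; lia⟩

/-- A double series over `ℤ × ℤ` may be summed by splitting according to the parity of the
difference of the indices. -/
theorem hasSum_of_hasSum_add_sub {f : ℤ × ℤ → ℂ} {a b : ℂ}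
    (hodd : HasSum (fun p : ℤ × ℤ => f (p.1 + p.2, p.1 - p.2 - 1)) a)
    (heven : HasSum (fun p : ℤ × ℤ => f (p.1 + p.2, p.1 - p.2)) b) : HasSum f (a + b) :=
  HasSum.add_isCompl isCompl_range_add_sub
    ((injective_add_sub_sub 1).hasSum_range_iff.2 hodd)
    ((by simpa using injective_add_sub_sub 0 :
      Function.Injective fun p : ℤ × ℤ => (p.1 + p.2, p.1 - p.2)).hasSum_range_iff.2 heven)

theorem θfTerm_one_one_mul_of_odd_sub (x y τ : ℂ) (k l : ℤ) :
    θfTerm 1 1 (x + y) τ (k + l) * θfTerm 1 1 (x - y) τ (k - l - 1) =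
      θfTerm 0 0 (2 * x) (2 * τ) k * θfTerm 1 0 (2 * y) (2 * τ) l := by
  simp only [θfTerm, ← Complex.exp_add]
  rw [← exp_add_intCast_mul_two_pi_mul_I _ (-k)]
  congr 1
  push_cast
  ring

theorem θfTerm_one_one_mul_of_even_sub (x y τ : ℂ) (k l : ℤ) :
    θfTerm 1 1 (x + y) τ (k + l) * θfTerm 1 1 (x - y) τ (k - l) =
      -(θfTerm 1 0 (2 * x) (2 * τ) k * θfTerm 0 0 (2 * y) (2 * τ) l) := by
  simp only [θfTerm, ← Complex.exp_add]
  rw [neg_eq_neg_one_mul (Complex.exp _), ← Complex.exp_pi_mul_I, ← Complex.exp_add,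
    ← exp_add_intCast_mul_two_pi_mul_I (Real.pi * Complex.I + _) k]
  congr 1
  push_cast
  ring

/-- The addition formula for the odd theta function, in terms of theta functions at `2τ`. -/
theorem θf_one_one_add_mul_θf_one_one_sub (x y : ℂ) {τ : ℂ} (hτ : 0 < τ.im) :
    θf 1 1 (x + y) τ * θf 1 1 (x - y) τ =
      θf 0 0 (2 * x) (2 * τ) * θf 1 0 (2 * y) (2 * τ) -
        θf 1 0 (2 * x) (2 * τ) * θf 0 0 (2 * y) (2 * τ) := by
  have hτ' : 0 < (2 * τ).im := by simpa using hτ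
  have hodd := (hasSum_θfTerm_mul_θfTerm 0 0 1 0 (2 * x) (2 * y) hτ').congr_fun
    fun p => θfTerm_one_one_mul_of_odd_sub x y τ p.1 p.2
  have heven := (hasSum_θfTerm_mul_θfTerm 1 0 0 0 (2 * x) (2 * y) hτ').neg.congr_fun
    fun p => θfTerm_one_one_mul_of_even_sub x y τ p.1 p.2
  rw [sub_eq_add_neg (θf 0 0 _ _ * _)]
  exact (hasSum_θfTerm_mul_θfTerm 1 1 1 1 (x + y) (x - y) hτ).unique
    (hasSum_of_hasSum_add_sub hodd heven)

/-- A form of the Weierstrass three-term identity. -/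
theorem θf_one_one_three_term (v a b : ℂ) {τ : ℂ} (hτ : 0 < τ.im) :
    θf 1 1 b τ ^ 2 * (θf 1 1 (v + a) τ * θf 1 1 (v - a) τ) -
      θf 1 1 a τ ^ 2 * (θf 1 1 (v + b) τ * θf 1 1 (v - b) τ) +
        θf 1 1 (a + b) τ * θf 1 1 (a - b) τ * θf 1 1 v τ ^ 2 = 0 := by
  have h : ∀ z, θf 1 1 z τ ^ 2 =
      θf 0 0 (2 * z) (2 * τ) * θf 1 0 (2 * 0) (2 * τ) -
        θf 1 0 (2 * z) (2 * τ) * θf 0 0 (2 * 0) (2 * τ) := fun z => by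
    rw [← θf_one_one_add_mul_θf_one_one_sub z 0 hτ, add_zero, sub_zero, sq]
  simp only [h, θf_one_one_add_mul_θf_one_one_sub _ _ hτ]
  ring

theorem two_theta_sum_four (ζ : ℂ) (τ : ℂ) (hτ : 0 < τ.im) :
    θ 1 (3/5) τ ^ 2 * θf (1/5) (1/5) ζ τ * θf (1/5) (3/5) ζ τ + ζ₅ ^ 2 * θ 1 (1/5) τ ^ 2 * θf (1/5) 1 ζ τ * θf (1/5) (9/5) ζ τ - ζ₅ ^ 2 * θ 1 (1/5) τ * θ 1 (3/5) τ * θf (1/5) (7/5) ζ τ ^ 2 = 0 := by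
  have hθ : ∀ ε' : ℝ, θ 1 ε' τ = -θf 1 1 ((1 - (ε' : ℂ)) / 2) τ := fun ε' => by
    rw [θ, θf_eq_exp_mul_θf_one_one, ← θf_one_one_neg]
    simp only [ofReal_one, sub_self, zero_div, ne_eq, OfNat.ofNat_ne_zero, not_false_eq_true,
      zero_pow, mul_zero, zero_mul, add_zero, Complex.exp_zero, one_mul, zero_add]
    congr 1
    ring
  obtain ⟨v, hv⟩ : ∃ v, v = ζ - 2 / 5 * τ + 1 / 5 := ⟨_, rfl⟩
  obtain ⟨E, hE⟩ : ∃ E : ℝ → ℂ, E = fun ε' : ℝ => Complex.exp (2 * Real.pi * Complex.I *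
      ((2 / 25) * τ - 2 / 5 * (ζ + (ε' : ℂ) / 2))) := ⟨_, rfl⟩
  have hshift : ∀ ε' : ℝ, θf (1 / 5) ε' ζ τ =
      E ε' * θf 1 1 (v + ((ε' : ℂ) / 2 - 7 / 10)) τ := fun ε' => by
    rw [θf_eq_exp_mul_θf_one_one, hE, hv]
    congr 2
    · push_cast; ring
    · push_cast; ring
  have hE₁ : E (1 / 5) * E (3 / 5) = ζ₅ ^ 2 * E (7 / 5) ^ 2 := by
    simp only [hE, ζ₅, ← Complex.exp_add, ← Complex.exp_nat_mul]
    congr 1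
    push_cast
    ring
  have hE₂ : E 1 * E (9 / 5) = E (7 / 5) ^ 2 := by
    simp only [hE, ← Complex.exp_add, ← Complex.exp_nat_mul]
    congr 1
    push_cast
    ring
  have h₁ : θf 1 1 (v + 2 / 5) τ = -θf 1 1 (v - 3 / 5) τ := by
    rw [← θf_one_one_add_one]
    congr 1
    ring
  have h₂ : θf 1 1 (2 / 5 + 1 / 5) τ = θf 1 1 (2 / 5) τ := by
    rw [← neg_neg (θf 1 1 (2 / 5) τ), ← θf_one_one_neg, ← θf_one_one_add_one]
    congr 1
    ring
  have key := θf_one_one_three_term v (2 / 5) (1 / 5) hτ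
  rw [h₁, h₂] at key
  simp only [hθ, hshift]
  norm_num [← sub_eq_add_neg] at key ⊢
  linear_combination
    θf 1 1 (1 / 5) τ ^ 2 * θf 1 1 (v - 3 / 5) τ * θf 1 1 (v - 2 / 5) τ * hE₁ +
      ζ₅ ^ 2 * θf 1 1 (2 / 5) τ ^ 2 * θf 1 1 (v - 1 / 5) τ * θf 1 1 (v + 1 / 5) τ * hE₂ -
      ζ₅ ^ 2 * E (7 / 5) ^ 2 * key
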